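/- Let Γ={g₁,…,g_k} be a finite set of orientation-preserving circle homeomorphisms whose action is equicontinuous, let p=(p₁,…,p_k) be a probability vector with all pᵢ>0, and let P be the associated Markov operator with dual P*. Assume that for every continuous f:S¹→ℝ with f≥0 and f not identically 0 there exists r∈ℕ such that (P*)ʳf(x)>0 for all x∈S¹. Then (Γ,p) is asymptotically stable: P has a unique invariant Borel probability measure μ* and for every Borel probability measure μ on S¹ and every continuous f, ∫ f d(Pⁿμ) → ∫ f dμ* as n→∞. -/

import Mathlib

open MeasureTheory Filter Topology

noncomputable section

/-- The circle `ℝ/ℤ` with normalized arc length (Haar probability measure as `volume`). -/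
abbrev S1 : Type := UnitAddCircle

/-- `h` is an orientation-preserving circle homeomorphism: it admits a strictly increasing
continuous lift `G : ℝ → ℝ` with `G (t+1) = G t + 1`. -/
def IsOPH (h : S1 ≃ₜ S1) : Prop :=
  ∃ G : ℝ → ℝ, StrictMono G ∧ Continuous G ∧ (∀ t, G (t + 1) = G t + 1) ∧
    ∀ t : ℝ, h ((t : ℝ) : S1) = ((G t : ℝ) : S1)

/-- For a word `w = [i₁, …, i_n]`, `applyWord g w = g_{i_n} ∘ ⋯ ∘ g_{i_1}`. -/
def applyWord {k : ℕ} (g : Fin k → S1 ≃ₜ S1) (w : List (Fin k)) (x : S1) : S1 :=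
  w.foldl (fun y i => g i y) x

/-- `Γ` is admissible: some generator has a dense forward orbit `{gᵢⁿ x : n ≥ 1}`. -/
def Admissible {k : ℕ} (g : Fin k → S1 ≃ₜ S1) : Prop :=
  ∃ i : Fin k, ∃ x : S1, Dense (Set.range fun n : ℕ => (⇑(g i))^[n + 1] x)

/-- The action of `Γ` is contractive: every `x` has an open arc neighbourhood whose image
under suitable words has Haar measure tending to `0`. -/
def Contractive {k : ℕ} (g : Fin k → S1 ≃ₜ S1) : Prop :=
  ∀ x : S1, ∃ a b : ℝ, a < b ∧ b - a < 1 ∧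
    x ∈ (fun t : ℝ => (t : S1)) '' Set.Ioo a b ∧
    ∃ w : ℕ → List (Fin k),
      Tendsto (fun m => volume (applyWord g (w m) '' ((fun t : ℝ => (t : S1)) '' Set.Ioo a b)))
        atTop (𝓝 0)

/-- The Markov operator `P μ = ∑ᵢ pᵢ • (gᵢ)_* μ` of the IFS `(Γ, p)`. -/
def markovP {k : ℕ} (p : Fin k → ℝ) (g : Fin k → S1 ≃ₜ S1) (μ : Measure S1) : Measure S1 :=
  ∑ i : Fin k, ENNReal.ofReal (p i) • Measure.map (g i) μ

/-- The dual operator `P* f x = ∑ᵢ pᵢ f (gᵢ x)`. -/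
def dualP {k : ℕ} (p : Fin k → ℝ) (g : Fin k → S1 ≃ₜ S1) (f : S1 → ℝ) (x : S1) : ℝ :=
  ∑ i : Fin k, p i * f (g i x)

/-- Asymptotic stability of the IFS `(Γ, p)`: there is a unique invariant Borel probability
measure `μ*`, and `Pⁿ μ → μ*` weakly for every Borel probability measure `μ`. -/
def AsympStable {k : ℕ} (p : Fin k → ℝ) (g : Fin k → S1 ≃ₜ S1) : Prop :=
  ∃ μs : Measure S1, IsProbabilityMeasure μs ∧ markovP p g μs = μs ∧
    (∀ ν : Measure S1, IsProbabilityMeasure ν → markovP p g ν = ν → ν = μs) ∧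
    ∀ μ : Measure S1, IsProbabilityMeasure μ → ∀ f : C(S1, ℝ),
      Tendsto (fun n => ∫ x, f x ∂((markovP p g)^[n] μ)) atTop (𝓝 (∫ x, f x ∂μs))

section PositiveOperator

variable {X : Type*} [TopologicalSpace X]

variable {L : C(X, ℝ) →ₗ[ℝ] C(X, ℝ)}

theorem monotone_of_positive (hpos : ∀ f, 0 ≤ f → 0 ≤ L f) : Monotone L := fun f g hfg => by
  simpa using hpos (g - f) (sub_nonneg.2 hfg)

theorem map_const_of_map_one (h1 : L 1 = 1) (c : ℝ) :
    L (ContinuousMap.const X c) = ContinuousMap.const X c := by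
  have : ContinuousMap.const X c = c • (1 : C(X, ℝ)) := by ext; simp
  rw [this, map_smul, h1]

variable [CompactSpace X]

theorem exists_subseq_tendsto_of_equicontinuous (u : ℕ → C(X, ℝ)) (C : ℝ)
    (hC : ∀ n, ‖u n‖ ≤ C) (hu : Equicontinuous fun n => ⇑(u n)) :
    ∃ h : C(X, ℝ), ∃ φ : ℕ → ℕ, StrictMono φ ∧ Tendsto (u ∘ φ) atTop (𝓝 h) := by
  let e := ContinuousMap.isometryEquivBoundedOfCompact X ℝ
  have hcomp : IsCompact (closure (Set.range (e ∘ u))) := by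
    refine BoundedContinuousFunction.arzela_ascoli (Metric.closedBall 0 C)
      (isCompact_closedBall 0 C) _ ?_ ?_
    · rintro _ x ⟨n, rfl⟩
      exact mem_closedBall_zero_iff.2 (((u n).norm_coe_le_norm x).trans (hC n))
    · intro x U hU
      filter_upwards [hu x U hU] with y hy
      rintro ⟨_, n, rfl⟩
      exact hy n
  obtain ⟨h, -, φ, hφ, hlim⟩ :=
    hcomp.tendsto_subseq fun n => subset_closure (Set.mem_range_self (f := e ∘ u) n)
  refine ⟨e.symm h, φ, hφ, ?_⟩
  have := (e.symm.continuous.tendsto h).comp hlim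
  refine this.congr fun n => ?_
  simp

theorem ContinuousMap.bddAbove_range_of_compactSpace (f : C(X, ℝ)) : BddAbove (Set.range f) :=
  (isCompact_range f.continuous).bddAbove

theorem norm_map_le_of_positive (hpos : ∀ f, 0 ≤ f → 0 ≤ L f) (h1 : L 1 = 1) (f : C(X, ℝ)) :
    ‖L f‖ ≤ ‖f‖ := by
  refine (ContinuousMap.norm_le _ (norm_nonneg f)).2 fun x => abs_le.2 ⟨?_, ?_⟩
  · have h : ContinuousMap.const X (-‖f‖) ≤ f := fun y => (abs_le.1 (f.norm_coe_le_norm y)).1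
    simpa [map_const_of_map_one h1] using monotone_of_positive hpos h x
  · have h : f ≤ ContinuousMap.const X ‖f‖ := fun y => (abs_le.1 (f.norm_coe_le_norm y)).2
    simpa [map_const_of_map_one h1] using monotone_of_positive hpos h x

variable [Nonempty X]

theorem ContinuousMap.exists_eq_iSup (f : C(X, ℝ)) : ∃ x, f x = ⨆ y, f y := by
  obtain ⟨x, hx⟩ := (isCompact_range f.continuous).sSup_mem (Set.range_nonempty f)
  exact ⟨x, hx⟩

theorem ContinuousMap.continuous_iSup_apply : Continuous fun f : C(X, ℝ) => ⨆ x, f x := by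
  refine (LipschitzWith.of_le_add fun f g => ciSup_le fun x => ?_ : LipschitzWith 1 _).continuous
  have h₁ := (abs_le.1 (ContinuousMap.dist_apply_le_dist (f := f) (g := g) x)).2
  have h₂ := le_ciSup g.bddAbove_range_of_compactSpace x
  linarith

/-- The iterates of a positive unital operator which is primitive and has equicontinuous orbits
converge uniformly to constants. -/
theorem exists_tendsto_iterate_const (hpos : ∀ f, 0 ≤ f → 0 ≤ L f) (h1 : L 1 = 1)
    (hprim : ∀ f, 0 ≤ f → f ≠ 0 → ∃ r : ℕ, ∀ x, 0 < (L^[r] f) x)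
    (f : C(X, ℝ)) (hf : Equicontinuous fun n => ⇑(L^[n] f)) :
    ∃ c : ℝ, Tendsto (fun n => L^[n] f) atTop (𝓝 (ContinuousMap.const X c)) := by
  have hnorm := norm_map_le_of_positive hpos h1
  have hcont : Continuous L := by
    refine (AddMonoidHomClass.lipschitz_of_bound L 1 fun f => ?_).continuous
    simpa using hnorm f
  have hbound : ∀ n, ‖L^[n] f‖ ≤ ‖f‖ := fun n => by
    induction n with
    | zero => simp
    | succ n ih => rw [Function.iterate_succ_apply']; exact (hnorm _).trans ih
  obtain ⟨h, φ, hφ, hlim⟩ := exists_subseq_tendsto_of_equicontinuous _ _ hbound hf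
  have hanti : Antitone fun n => ⨆ x, (L^[n] f) x := antitone_nat_of_succ_le fun n => by
    refine ciSup_le fun x => ?_
    have hle : L^[n] f ≤ ContinuousMap.const X (⨆ x, (L^[n] f) x) := fun y =>
      le_ciSup (L^[n] f).bddAbove_range_of_compactSpace y
    rw [Function.iterate_succ_apply']
    simpa [map_const_of_map_one h1] using monotone_of_positive hpos hle x
  have hbdd : BddBelow (Set.range fun n => ⨆ x, (L^[n] f) x) := by
    refine ⟨-‖f‖, ?_⟩
    rintro _ ⟨n, rfl⟩
    obtain ⟨x⟩ := ‹Nonempty X›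
    refine le_trans ?_ (le_ciSup (L^[n] f).bddAbove_range_of_compactSpace x)
    exact (abs_le.1 (((L^[n] f).norm_coe_le_norm x).trans (hbound n))).1
  set M := ⨅ n, ⨆ x, (L^[n] f) x
  have hM : Tendsto (fun n => ⨆ x, (L^[n] f) x) atTop (𝓝 M) := tendsto_atTop_ciInf hanti hbdd
  have hsup : ∀ r : ℕ, ⨆ x, (L^[r] h) x = M := fun r => by
    have hr := ((ContinuousMap.continuous_iSup_apply.comp (hcont.iterate r)).tendsto h).comp hlim
    refine tendsto_nhds_unique hr ?_
    refine (hM.comp ((tendsto_add_atTop_nat r).comp hφ.tendsto_atTop)).congr fun j => ?_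
    simp [add_comm _ r, Function.iterate_add_apply]
  have hconst : h = ContinuousMap.const X M := by
    by_contra hne
    have hle : 0 ≤ ContinuousMap.const X M - h := sub_nonneg.2 fun x => by
      simpa using (le_ciSup h.bddAbove_range_of_compactSpace x).trans (hsup 0).le
    obtain ⟨r, hr⟩ := hprim _ hle (sub_ne_zero.2 (Ne.symm hne))
    obtain ⟨x, hx⟩ := (L^[r] h).exists_eq_iSup
    have hx' := hr x
    rw [iterate_map_sub, Function.iterate_fixed (map_const_of_map_one h1 M)] at hx'
    simp [hx, hsup r] at hx'
  refine ⟨M, ?_⟩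
  rw [tendsto_iff_dist_tendsto_zero]
  have hdist : Antitone fun n => dist (L^[n] f) (ContinuousMap.const X M) :=
    antitone_nat_of_succ_le fun n => by
      rw [Function.iterate_succ_apply', dist_eq_norm, dist_eq_norm]
      conv_lhs => rw [← map_const_of_map_one h1 M, ← map_sub]
      exact hnorm _
  refine (tendsto_iff_tendsto_subseq_of_antitone hdist hφ.tendsto_atTop).2 ?_
  exact tendsto_iff_dist_tendsto_zero.1 (hconst ▸ hlim)

end PositiveOperator

section MarkovOperator

variable {k : ℕ} {p : Fin k → ℝ} {g : Fin k → S1 ≃ₜ S1}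

/-- The dual Markov operator as a linear operator on continuous functions. -/
def dualOp (p : Fin k → ℝ) (g : Fin k → S1 ≃ₜ S1) : C(S1, ℝ) →ₗ[ℝ] C(S1, ℝ) :=
  ∑ i, p i • (ContinuousMap.compRightAlgHom ℝ ℝ (g i : C(S1, S1))).toLinearMap

theorem coe_dualOp (f : C(S1, ℝ)) : ⇑(dualOp p g f) = dualP p g f := by
  ext x
  simp [dualOp, dualP, ContinuousMap.sum_apply]

theorem coe_iterate_dualOp (n : ℕ) (f : C(S1, ℝ)) :
    ⇑((dualOp p g)^[n] f) = (dualP p g)^[n] f := by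
  induction n with
  | zero => rfl
  | succ n ih => rw [Function.iterate_succ_apply', Function.iterate_succ_apply', coe_dualOp, ih]

theorem dualOp_one (hsum : ∑ i, p i = 1) : dualOp p g 1 = 1 := by
  ext x
  simp [coe_dualOp, dualP, hsum]

theorem dualOp_nonneg (hp : ∀ i, 0 ≤ p i) (f : C(S1, ℝ)) (hf : 0 ≤ f) : 0 ≤ dualOp p g f :=
  fun x => by
    change 0 ≤ dualOp p g f x
    rw [coe_dualOp]
    exact Finset.sum_nonneg fun i _ => mul_nonneg (hp i) (hf (g i x))

theorem abs_iterate_dualP_sub_le (hp : ∀ i, 0 ≤ p i) (hsum : ∑ i, p i = 1) {f : S1 → ℝ} {ε : ℝ}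
    (n : ℕ) {x y : S1} (h : ∀ w, |f (applyWord g w x) - f (applyWord g w y)| ≤ ε) :
    |(dualP p g)^[n] f x - (dualP p g)^[n] f y| ≤ ε := by
  induction n generalizing x y with
  | zero => exact h []
  | succ n ih =>
    rw [Function.iterate_succ_apply']
    calc |dualP p g ((dualP p g)^[n] f) x - dualP p g ((dualP p g)^[n] f) y|
        = |∑ i, p i * ((dualP p g)^[n] f (g i x) - (dualP p g)^[n] f (g i y))| := by
          simp only [dualP, mul_sub, Finset.sum_sub_distrib]
      _ ≤ ∑ i, |p i * ((dualP p g)^[n] f (g i x) - (dualP p g)^[n] f (g i y))| :=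
          Finset.abs_sum_le_sum_abs _ _
      _ ≤ ∑ i, p i * ε := Finset.sum_le_sum fun i _ => by
          rw [abs_mul, abs_of_nonneg (hp i)]
          exact mul_le_mul_of_nonneg_left (ih fun w => h (i :: w)) (hp i)
      _ = ε := by rw [← Finset.sum_mul, hsum, one_mul]

theorem equicontinuous_iterate_dualP (hp : ∀ i, 0 ≤ p i) (hsum : ∑ i, p i = 1)
    (hequi : Equicontinuous fun w => applyWord g w) {f : S1 → ℝ} (hf : UniformContinuous f) :
    Equicontinuous fun n => (dualP p g)^[n] f := by
  intro x
  rw [Metric.equicontinuousAt_iff_right]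
  intro ε hε
  obtain ⟨δ, hδ, hfδ⟩ := Metric.uniformContinuous_iff.1 hf (ε / 2) (half_pos hε)
  filter_upwards [Metric.equicontinuousAt_iff_right.1 (hequi x) δ hδ] with y hy n
  refine lt_of_le_of_lt ?_ (half_lt_self hε)
  exact abs_iterate_dualP_sub_le hp hsum n fun w => (hfδ (hy w)).le

theorem isProbabilityMeasure_markovP (hp : ∀ i, 0 ≤ p i) (hsum : ∑ i, p i = 1)
    (μ : Measure S1) [IsProbabilityMeasure μ] : IsProbabilityMeasure (markovP p g μ) := by
  constructor
  have h (i : Fin k) : Measure.map (g i) μ Set.univ = 1 := by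
    rw [Measure.map_apply (g i).continuous.measurable MeasurableSet.univ]
    simp
  simp [markovP, h, ← ENNReal.ofReal_sum_of_nonneg fun i _ => hp i, hsum]

theorem isProbabilityMeasure_iterate_markovP (hp : ∀ i, 0 ≤ p i) (hsum : ∑ i, p i = 1)
    (μ : Measure S1) [IsProbabilityMeasure μ] (n : ℕ) :
    IsProbabilityMeasure ((markovP p g)^[n] μ) := by
  induction n with
  | zero => assumption
  | succ n ih =>
    rw [Function.iterate_succ_apply']
    exact isProbabilityMeasure_markovP hp hsum _

theorem integral_markovP (hp : ∀ i, 0 ≤ p i) (μ : Measure S1) [IsProbabilityMeasure μ]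
    (f : C(S1, ℝ)) : ∫ x, f x ∂(markovP p g μ) = ∫ x, dualOp p g f x ∂μ := by
  have hmap (i : Fin k) : ∫ x, f x ∂(Measure.map (g i) μ) = ∫ x, f (g i x) ∂μ :=
    (g i).measurableEmbedding.integral_map f
  have hint (i : Fin k) : Integrable (fun x => f (g i x)) μ :=
    (f.comp (g i : C(S1, S1))).continuous.integrable_of_hasCompactSupport
      (HasCompactSupport.of_compactSpace _)
  have hint' (i : Fin k) : Integrable f (ENNReal.ofReal (p i) • Measure.map (g i) μ) :=
    ((g i).measurableEmbedding.integrable_map_iff.2 (hint i)).smul_measure ENNReal.ofReal_ne_top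
  rw [coe_dualOp, markovP, integral_finsetSum_measure fun i _ => hint' i]
  simp only [dualP]
  rw [integral_finsetSum _ fun i _ => (hint i).const_mul (p i)]
  refine Finset.sum_congr rfl fun i _ => ?_
  rw [integral_smul_measure, hmap, integral_const_mul, ENNReal.toReal_ofReal (hp i), smul_eq_mul]

theorem integral_iterate_markovP (hp : ∀ i, 0 ≤ p i) (hsum : ∑ i, p i = 1)
    (μ : Measure S1) [IsProbabilityMeasure μ] (n : ℕ) (f : C(S1, ℝ)) :
    ∫ x, f x ∂((markovP p g)^[n] μ) = ∫ x, (dualOp p g)^[n] f x ∂μ := by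
  induction n generalizing f with
  | zero => rfl
  | succ n ih =>
    have := isProbabilityMeasure_iterate_markovP (g := g) hp hsum μ n
    rw [Function.iterate_succ_apply', Function.iterate_succ_apply, integral_markovP hp, ih]

end MarkovOperator

theorem ContinuousMap.tendsto_integral {X : Type*} [TopologicalSpace X] [CompactSpace X]
    [MeasurableSpace X] [BorelSpace X] (μ : Measure X) [IsProbabilityMeasure μ]
    {u : ℕ → C(X, ℝ)} {h : C(X, ℝ)} (hu : Tendsto u atTop (𝓝 h)) :
    Tendsto (fun n => ∫ x, u n x ∂μ) atTop (𝓝 (∫ x, h x ∂μ)) := by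
  have hint (f : C(X, ℝ)) : Integrable f μ :=
    f.continuous.integrable_of_hasCompactSupport (HasCompactSupport.of_compactSpace _)
  rw [tendsto_iff_dist_tendsto_zero] at hu ⊢
  refine squeeze_zero (fun _ => dist_nonneg) (fun n => ?_) hu
  rw [dist_eq_norm, dist_eq_norm, ← integral_sub (hint _) (hint _)]
  simpa using norm_integral_le_of_norm_le_const (μ := μ)
    (Filter.Eventually.of_forall (u n - h).norm_coe_le_norm)

theorem measure_eq_of_forall_integral_continuousMap_eq {X : Type*} [TopologicalSpace X]
    [CompactSpace X] [MeasurableSpace X] [BorelSpace X] [HasOuterApproxClosed X]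
    {μ ν : Measure X} [IsFiniteMeasure μ] [IsFiniteMeasure ν]
    (h : ∀ f : C(X, ℝ), ∫ x, f x ∂μ = ∫ x, f x ∂ν) : μ = ν :=
  ext_of_forall_integral_eq_of_IsFiniteMeasure fun f => h f.toContinuousMap

/-- If the action of `Γ` is equicontinuous and for every nonzero nonnegative
continuous `f` some iterate `(P*)ʳ f` is strictly positive everywhere, then the IFS `(Γ, p)`
is asymptotically stable. -/
theorem equicontinuous_primitive_asymptotically_stable {k : ℕ} (g : Fin k → S1 ≃ₜ S1)
    (hg : ∀ i, IsOPH (g i))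
    (hequi : Equicontinuous (fun w : List (Fin k) => applyWord g w))
    (p : Fin k → ℝ) (hp : ∀ i, 0 < p i) (hsum : ∑ i, p i = 1)
    (hpos : ∀ f : C(S1, ℝ), (∀ x, 0 ≤ f x) → (∃ x, f x ≠ 0) →
      ∃ r : ℕ, ∀ x : S1, 0 < (dualP p g)^[r] f x) :
    AsympStable p g := by
  have hp₀ (i : Fin k) : 0 ≤ p i := (hp i).le
  have hlim (f : C(S1, ℝ)) :
      ∃ c : ℝ, Tendsto (fun n => (dualOp p g)^[n] f) atTop (𝓝 (ContinuousMap.const S1 c)) := by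
    refine exists_tendsto_iterate_const (dualOp_nonneg hp₀) (dualOp_one hsum) ?_ f ?_
    · intro f hf hne
      obtain ⟨r, hr⟩ := hpos f hf (DFunLike.ne_iff.1 hne)
      exact ⟨r, fun x => by rw [coe_iterate_dualOp]; exact hr x⟩
    · simp only [coe_iterate_dualOp]
      exact equicontinuous_iterate_dualP hp₀ hsum hequi
        (CompactSpace.uniformContinuous_of_continuous f.continuous)
  choose c hc using hlim
  have hconv (μ : Measure S1) [IsProbabilityMeasure μ] (f : C(S1, ℝ)) :
      Tendsto (fun n => ∫ x, f x ∂((markovP p g)^[n] μ)) atTop (𝓝 (c f)) := by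
    simp only [integral_iterate_markovP hp₀ hsum]
    simpa using ContinuousMap.tendsto_integral μ (hc f)
  have hinv (ν : Measure S1) [IsProbabilityMeasure ν] (hν : markovP p g ν = ν) (f : C(S1, ℝ)) :
      ∫ x, f x ∂ν = c f := by
    refine tendsto_nhds_unique ?_ (hconv ν f)
    simp only [Function.iterate_fixed hν]
    exact tendsto_const_nhds
  let orbit (n : ℕ) : ProbabilityMeasure S1 :=
    ⟨(markovP p g)^[n] (.dirac 0), isProbabilityMeasure_iterate_markovP hp₀ hsum _ n⟩
  obtain ⟨μs, hμs⟩ := exists_clusterPt_of_compactSpace (map orbit atTop)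
  have hμs_int (f : C(S1, ℝ)) : ∫ x, f x ∂(μs : Measure S1) = c f := by
    have hcl := MapClusterPt.tendsto_comp (u := orbit) (F := atTop)
      ((ProbabilityMeasure.continuous_integral_boundedContinuousFunction
        (BoundedContinuousFunction.mkOfCompact f)).tendsto μs) hμs
    have : (𝓝 (∫ x, f x ∂(μs : Measure S1)) ⊓ 𝓝 (c f)).NeBot :=
      ClusterPt.mono hcl (hconv (.dirac 0) f)
    exact eq_of_nhds_neBot this
  have hc_dual (f : C(S1, ℝ)) : c (dualOp p g f) = c f := by
    have h := (tendsto_add_atTop_iff_nat 1).2 (hconv (.dirac 0) f)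
    refine tendsto_nhds_unique (hconv (.dirac 0) (dualOp p g f)) (h.congr fun n => ?_)
    rw [integral_iterate_markovP hp₀ hsum, integral_iterate_markovP hp₀ hsum,
      Function.iterate_succ_apply]
  have hμs_prob := isProbabilityMeasure_markovP (g := g) hp₀ hsum (μs : Measure S1)
  refine ⟨μs, inferInstance, ?_, fun ν _ hν => ?_, fun μ _ f => ?_⟩
  · refine measure_eq_of_forall_integral_continuousMap_eq fun f => ?_
    rw [integral_markovP hp₀, hμs_int, hμs_int, hc_dual]
  · exact measure_eq_of_forall_integral_continuousMap_eq fun f => by rw [hinv ν hν, hμs_int]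
  · rw [hμs_int]
    exact hconv μ f
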